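/- Let Γ = {1324, 123}. For n ≥ 0 and 0 ≤ k ≤ n, let F_{2n,2k} be the set of pairs (B, σ) where B = (b_1, …, b_ℓ) is a composition of 2n having exactly 2k parts equal to 1 and exactly n−k parts equal to 2 (so ℓ = n+k), σ ∈ S_{2n}, σ is increasing within each brick, the first entries of the bricks increase from left to right, and whenever σ has a descent at the boundary between two consecutive bricks there is a Γ-match of σ contained entirely in the positions covered by those two bricks. Then |F_{2n,2k}| = (2k+1)·binom(2n, n−k)/(n+k+1). -/

import Mathlib

open Polynomial

/-- The reduction of a list of distinct integers: replace the i-th smallest entry by i. -/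
def redL (l : List ℕ) : List ℕ :=
  l.map (fun x => (l.countP (fun y => decide (y < x))) + 1)

/-- The number of descents of a list. -/
def desL (l : List ℕ) : ℕ :=
  (l.zip l.tail).countP (fun p => decide (p.2 < p.1))

/-- `σ` has a `Γ`-match: some consecutive factor of length at least 2 reduces to a member of `Γ`. -/
def HasMatch (Γ : Set (List ℕ)) (l : List ℕ) : Prop :=
  ∃ i j : ℕ, 1 ≤ j ∧ i + j + 1 ≤ l.length ∧ redL ((l.drop i).take (j + 1)) ∈ Γ

open scoped Classical in
/-- The set of permutations of `{1,…,n}` (in one-line notation, as lists) with no `Γ`-match. -/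
noncomputable def NMfinset (Γ : Set (List ℕ)) (n : ℕ) : Finset (List ℕ) :=
  ((List.range' 1 n).permutations.toFinset).filter (fun l => ¬ HasMatch Γ l)

/-- `NM_{Γ,n}(y) = Σ_{σ ∈ NM_n(Γ)} y^{1+des(σ)}` for `n ≥ 1`, and `NM_{Γ,0}(y) = 1`. -/
noncomputable def NMpoly (Γ : Set (List ℕ)) (n : ℕ) : Polynomial ℚ :=
  if n = 0 then 1 else ∑ l ∈ NMfinset Γ n, X ^ (1 + desL l)

/-- Conditions on a pair `(B, σ)`: `σ` is increasing within each brick, the first entries of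
the bricks increase from left to right, and whenever `σ` has a descent at a brick boundary,
there is a `Γ`-match of `σ` contained in the positions covered by the two adjacent bricks. -/
def FixedPt (Γ : Set (List ℕ)) (n : ℕ) (c : Composition n) (σ : List ℕ) : Prop :=
  (∀ p : ℕ, p + 1 < n → (¬ ∃ i, i < c.length ∧ c.sizeUpTo i = p + 1) →
    σ.getD p 0 < σ.getD (p + 1) 0) ∧
  (∀ i : ℕ, i + 1 < c.length →
    σ.getD (c.sizeUpTo i) 0 < σ.getD (c.sizeUpTo (i + 1)) 0) ∧
  (∀ i : ℕ, i + 1 < c.length →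
    σ.getD (c.sizeUpTo (i + 1)) 0 < σ.getD (c.sizeUpTo (i + 1) - 1) 0 →
    ∃ a j : ℕ, 1 ≤ j ∧ c.sizeUpTo i ≤ a ∧ a + j + 1 ≤ c.sizeUpTo (i + 2) ∧
      redL ((σ.drop a).take (j + 1)) ∈ Γ)

/-- Ballot numbers. -/
def bal : ℕ → ℕ → ℕ
  | 0, H => if H = 0 then 1 else 0
  | m + 1, 0 => bal m 1
  | m + 1, H + 1 => bal m (H + 2) + bal m H

lemma bal_zero_of_lt : ∀ (m H : ℕ), m < H → bal m H = 0
  | 0, H, h => by simp [bal]; omega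
  | m + 1, 0, h => by omega
  | m + 1, H + 1, h => by
    simp [bal, bal_zero_of_lt m (H + 2) (by omega), bal_zero_of_lt m H (by omega)]

lemma bal_closed : ∀ (m H j : ℕ), H + 2 * j = m →
    (bal m H : ℚ) = (H + 1) * (m.choose j : ℚ) / (H + j + 1)
  | 0, H, j, h => by
    obtain rfl : H = 0 := by omega
    obtain rfl : j = 0 := by omega
    simp [bal]
  | m + 1, 0, j, h => by
    obtain ⟨i, rfl⟩ : ∃ i, j = i + 1 := ⟨j - 1, by omega⟩
    have h1 := bal_closed m 1 i (by omega)
    have hc : ((m.choose (i + 1) : ℕ) : ℚ) * (i + 1) = m.choose i * (i + 1) := by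
      have := Nat.choose_succ_right_eq m i
      rw [show m - i = i + 1 by omega] at this
      exact_mod_cast this
    have hc' : ((m.choose (i + 1) : ℕ) : ℚ) = m.choose i :=
      mul_right_cancel₀ (by positivity) hc
    simp only [bal, h1, Nat.choose_succ_succ]
    push_cast
    rw [hc']
    field_simp
    ring
  | m + 1, H + 1, 0, h => by
    have h1 := bal_closed m H 0 (by omega)
    simp only [bal, bal_zero_of_lt m (H + 2) (by omega)]
    push_cast
    rw [h1]
    simp
    field_simp
  | m + 1, H + 1, i + 1, h => by
    have h1 := bal_closed m H (i + 1) (by omega)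
    have h2 := bal_closed m (H + 2) i (by omega)
    have hc : ((m.choose (i + 1) : ℕ) : ℚ) * (i + 1) = m.choose i * (H + i + 2) := by
      have := Nat.choose_succ_right_eq m i
      rw [show m - i = H + i + 2 by omega] at this
      exact_mod_cast this
    have hc' : ((m.choose (i + 1) : ℕ) : ℚ) = m.choose i * (H + i + 2) / (i + 1) := by
      field_simp; linarith
    simp only [bal, Nat.choose_succ_succ]
    push_cast
    rw [h1, h2, hc']
    push_cast
    field_simp
    ring

/-- flatten a list of bricks, where `(a, a)` is a brick of size 1. -/
def flat (L : List (ℕ × ℕ)) : List ℕ :=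
  L.flatMap (fun p => if p.1 = p.2 then [p.1] else [p.1, p.2])

/-- brick sizes -/
def blk (L : List (ℕ × ℕ)) : List ℕ := L.map (fun p => if p.1 = p.2 then 1 else 2)

@[simp] lemma flat_nil : flat [] = [] := rfl
@[simp] lemma blk_nil : blk [] = [] := rfl
lemma flat_cons (p L) : flat (p :: L) = (if p.1 = p.2 then [p.1] else [p.1, p.2]) ++ flat L := rfl
lemma blk_cons (p L) : blk (p :: L) = (if p.1 = p.2 then 1 else 2) :: blk L := rfl

lemma mem_flat (L : List (ℕ × ℕ)) (x : ℕ) : x ∈ flat L ↔ ∃ p ∈ L, x = p.1 ∨ x = p.2 := by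
  simp only [flat, List.mem_flatMap]
  refine exists_congr fun p => and_congr_right fun _ => ?_
  split_ifs with h <;> simp [h]

lemma length_flat (L : List (ℕ × ℕ)) : (flat L).length = (blk L).sum := by
  induction L with
  | nil => rfl
  | cons p L ih => rw [flat_cons, blk_cons]; split_ifs <;> simp [ih] <;> omega

lemma drop_flat (L : List (ℕ × ℕ)) (i : ℕ) :
    (flat L).drop ((blk L).take i).sum = flat (L.drop i) := by
  induction L generalizing i with
  | nil => simp
  | cons p L ih =>
    cases i with
    | zero => simp
    | succ i =>
      rw [flat_cons, blk_cons, List.take_succ_cons, List.sum_cons, List.drop_succ_cons, ← ih i]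
      split_ifs <;> simp [add_comm 1, add_comm 2]

/-- The recursively built family. -/
def T : ℕ → ℕ → ℕ → ℕ → Finset (List ℕ × List ℕ)
  | 0, _, h, s => if h = 0 ∧ s = 0 then {([], [])} else ∅
  | m + 1, v, 0, 0 => (T m (v + 1) 1 0).image (fun p => (v :: p.1, p.2))
  | m + 1, v, 0, s + 1 => (T m (v + 1) 1 (s + 1)).image (fun p => (v :: p.1, p.2)) ∪
      (T m (v + 1) 0 s).image (fun p => (v :: p.1, v :: p.2))
  | m + 1, v, h + 1, s => (T m (v + 1) (h + 2) s).image (fun p => (v :: p.1, p.2)) ∪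
      (T m (v + 1) h s).image (fun p => (p.1, v :: p.2))

/-- The explicit description of the family. -/
structure P (m v h s : ℕ) (A Z : List ℕ) : Prop where
  sA : A.Pairwise (· < ·)
  sZ : Z.Pairwise (· < ·)
  f : List.Forall₂ (· ≤ ·) A (Z.drop h)
  hl : h ≤ Z.length
  cnt : (blk (A.zip (Z.drop h))).count 1 = s
  pm : (flat (A.zip (Z.drop h)) ++ Z.take h).Perm (List.range' v m)

lemma mem_or {A Z : List ℕ} {h x : ℕ} (f : List.Forall₂ (· ≤ ·) A (Z.drop h)) :
    x ∈ flat (A.zip (Z.drop h)) ++ Z.take h ↔ x ∈ A ∨ x ∈ Z := by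
  have h2 : x ∈ Z ↔ x ∈ Z.take h ∨ x ∈ Z.drop h := by
    rw [← List.mem_append, List.take_append_drop]
  rw [List.mem_append, h2]
  have : x ∈ flat (A.zip (Z.drop h)) ↔ x ∈ A ∨ x ∈ Z.drop h := by
    generalize Z.drop h = Y at f
    induction f with
    | nil => simp
    | cons hab _ ih =>
      rw [List.zip_cons_cons, flat_cons]
      split_ifs with he
      · simp only at he
        subst he
        simp [ih]; tauto
      · simp [ih]; tauto
  rw [this]; tauto

lemma P.mem {m v h s A Z} (p : P m v h s A Z) (x : ℕ) :
    (x ∈ A ∨ x ∈ Z) ↔ v ≤ x ∧ x < v + m := by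
  rw [← mem_or p.f, p.pm.mem_iff, List.mem_range'_1]

lemma P_U {m v h s A Z} (p : P m (v + 1) (h + 1) s A Z) : P (m + 1) v h s (v :: A) Z := by
  have hh : h < Z.length := p.hl
  have hd : Z.drop h = Z[h] :: Z.drop (h + 1) := List.drop_eq_getElem_cons hh
  have ht : Z.take (h + 1) = Z.take h ++ [Z[h]] := (List.take_append_getElem hh).symm
  have hz := (p.mem Z[h]).1 (Or.inr (List.getElem_mem hh))
  have hne : v ≠ Z[h] := by omega
  refine ⟨?_, p.sZ, ?_, hh.le, ?_, ?_⟩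
  · refine List.pairwise_cons.2 ⟨fun x hx => ?_, p.sA⟩
    have := (p.mem x).1 (Or.inl hx); omega
  · rw [hd]; exact List.Forall₂.cons (by omega) p.f
  · rw [hd, List.zip_cons_cons, blk_cons]; simp [hne, p.cnt]
  · rw [hd, List.zip_cons_cons, flat_cons, List.range'_succ]
    simp only [hne, if_false, List.cons_append, List.nil_append]
    refine List.Perm.cons _ (List.Perm.trans ?_ p.pm)
    rw [ht, ← List.append_assoc]
    exact (List.perm_append_singleton _ _).symm

lemma P_D {m v h s A Z} (p : P m (v + 1) h s A Z) : P (m + 1) v (h + 1) s A (v :: Z) := by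
  refine ⟨p.sA, ?_, p.f, ?_, p.cnt, ?_⟩
  · refine List.pairwise_cons.2 ⟨fun x hx => ?_, p.sZ⟩
    have := (p.mem x).1 (Or.inr hx); omega
  · have := p.hl
    simpa using this
  · rw [List.range'_succ, List.take_succ_cons, List.drop_succ_cons]
    exact List.perm_middle.trans (p.pm.cons _)

lemma P_S {m v s A Z} (p : P m (v + 1) 0 s A Z) : P (m + 1) v 0 (s + 1) (v :: A) (v :: Z) := by
  have pf := p.f
  have pc := p.cnt
  have pp := p.pm
  simp only [List.drop_zero, List.take_zero, List.append_nil] at pf pc pp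
  refine ⟨?_, ?_, ?_, by simp, ?_, ?_⟩
  · refine List.pairwise_cons.2 ⟨fun x hx => ?_, p.sA⟩
    have := (p.mem x).1 (Or.inl hx); omega
  · refine List.pairwise_cons.2 ⟨fun x hx => ?_, p.sZ⟩
    have := (p.mem x).1 (Or.inr hx); omega
  · exact List.Forall₂.cons le_rfl pf
  · simp [blk_cons, pc]
  · simp [flat_cons, List.range'_succ, pp]

lemma head_of {v : ℕ} {A : List ℕ} (hA : A.Pairwise (· < ·)) (hv : v ∈ A) (h : ∀ x ∈ A, v ≤ x) :
    ∃ A', A = v :: A' := by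
  cases A with
  | nil => simp at hv
  | cons a A =>
    rw [List.pairwise_cons] at hA
    rcases List.mem_cons.1 hv with rfl | h'
    · exact ⟨A, rfl⟩
    · have := hA.1 v h'; have := h a (by simp); omega

lemma P_inv {m v h s A Z} (p : P (m + 1) v h s A Z) :
    (∃ A', A = v :: A' ∧ P m (v + 1) (h + 1) s A' Z) ∨
    (∃ Z' h', Z = v :: Z' ∧ h = h' + 1 ∧ P m (v + 1) h' s A Z') ∨
    (∃ A' Z' s', A = v :: A' ∧ Z = v :: Z' ∧ h = 0 ∧ s = s' + 1 ∧ P m (v + 1) 0 s' A' Z') := by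
  have hA : ∀ x ∈ A, v ≤ x := fun x hx => ((p.mem x).1 (Or.inl hx)).1
  have hZ : ∀ x ∈ Z, v ≤ x := fun x hx => ((p.mem x).1 (Or.inr hx)).1
  have hv := (p.mem v).2 ⟨le_rfl, by omega⟩
  have nd : (flat (A.zip (Z.drop h)) ++ Z.take h).Nodup := p.pm.nodup_iff.2 List.nodup_range'
  obtain ⟨sA, sZ, f, hl, cnt, pm⟩ := p
  by_cases vA : v ∈ A
  · obtain ⟨A', rfl⟩ := head_of sA vA hA
    have sA' := (List.pairwise_cons.1 sA).2
    by_cases vZ : v ∈ Z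
    · obtain ⟨Z', rfl⟩ := head_of sZ vZ hZ
      have sZ' := (List.pairwise_cons.1 sZ).2
      cases h with
      | zero =>
        simp only [List.drop_zero, List.take_zero, List.append_nil, List.zip_cons_cons, blk_cons,
          flat_cons, if_true, List.count_cons_self, List.range'_succ, List.singleton_append] at f cnt pm
        refine Or.inr (Or.inr ⟨A', Z', s - 1, rfl, rfl, rfl, by omega, sA', sZ', ?_, by simp, ?_, ?_⟩)
        · simpa using f
        · simp only [List.drop_zero]; omega
        · simpa using pm
      | succ h =>
        exfalso
        rw [List.nodup_append] at nd
        refine nd.2.2 v ?_ v (by simp) rfl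
        obtain ⟨b, u, hb, hf, e⟩ := List.forall₂_cons_left_iff.1 f
        rw [e, mem_flat]
        exact ⟨(v, b), by simp, Or.inl rfl⟩
    · left
      refine ⟨A', rfl, ?_⟩
      have hh : h < Z.length := by
        have := f.length_eq
        simp at this; omega
      have hd : Z.drop h = Z[h] :: Z.drop (h + 1) := List.drop_eq_getElem_cons hh
      have ht : Z.take (h + 1) = Z.take h ++ [Z[h]] := (List.take_append_getElem hh).symm
      have hne : v ≠ Z[h] := fun e => vZ (e ▸ List.getElem_mem hh)
      rw [hd] at f cnt pm
      rw [List.zip_cons_cons] at cnt pm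
      rw [flat_cons, List.range'_succ] at pm
      rw [blk_cons] at cnt
      simp only [hne, if_false, List.cons_append, List.nil_append] at cnt pm
      refine ⟨sA', sZ, (List.forall₂_cons.1 f).2, hh, ?_, ?_⟩
      · simpa using cnt
      · refine List.Perm.trans ?_ pm.cons_inv
        rw [ht, ← List.append_assoc]
        exact (List.perm_append_singleton _ _)
  · have vZ : v ∈ Z := by tauto
    obtain ⟨Z', rfl⟩ := head_of sZ vZ hZ
    have sZ' := (List.pairwise_cons.1 sZ).2
    cases h with
    | zero =>
      exfalso
      cases f with
      | cons hab _ =>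
        have := hA _ (List.mem_cons_self)
        have : v = _ := le_antisymm this hab
        subst this
        simp at vA
    | succ h =>
      right; left
      refine ⟨Z', h, rfl, rfl, sA, sZ', f, by simpa using hl, cnt, ?_⟩
      rw [List.range'_succ, List.take_succ_cons, List.drop_succ_cons] at pm
      exact (List.perm_middle.symm.trans pm).cons_inv

lemma mem_T (m v h s A Z) : (A, Z) ∈ T m v h s ↔ P m v h s A Z := by
  induction m generalizing v h s A Z with
  | zero =>
    simp only [T]
    constructor
    · intro hm
      split_ifs at hm with hc
      · obtain ⟨rfl, rfl⟩ := hc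
        simp at hm
        obtain ⟨rfl, rfl⟩ := hm
        exact ⟨by simp, by simp, by simp, by simp, by simp, by simp⟩
      · simp at hm
    · intro p
      have e1 : A = [] := List.eq_nil_iff_forall_not_mem.2 fun x hx => by
        have := (p.mem x).1 (Or.inl hx); omega
      have e2 : Z = [] := List.eq_nil_iff_forall_not_mem.2 fun x hx => by
        have := (p.mem x).1 (Or.inr hx); omega
      subst e1 e2
      have h1 := p.hl
      have h2 := p.cnt
      simp at h1 h2
      simp [h1, ← h2]
  | succ m ih =>
    constructor
    · intro hm
      cases h with
      | zero =>
        cases s with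
        | zero =>
          simp only [T, Finset.mem_image, Prod.exists, Prod.mk.injEq] at hm
          obtain ⟨a, b, hab, rfl, rfl⟩ := hm
          exact P_U ((ih _ _ _ _ _).1 hab)
        | succ s =>
          simp only [T, Finset.mem_union, Finset.mem_image, Prod.exists, Prod.mk.injEq] at hm
          obtain ⟨a, b, hab, rfl, rfl⟩ | ⟨a, b, hab, rfl, rfl⟩ := hm
          · exact P_U ((ih _ _ _ _ _).1 hab)
          · exact P_S ((ih _ _ _ _ _).1 hab)
      | succ h =>
        simp only [T, Finset.mem_union, Finset.mem_image, Prod.exists, Prod.mk.injEq] at hm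
        obtain ⟨a, b, hab, rfl, rfl⟩ | ⟨a, b, hab, rfl, rfl⟩ := hm
        · exact P_U ((ih _ _ _ _ _).1 hab)
        · exact P_D ((ih _ _ _ _ _).1 hab)
    · intro p
      obtain ⟨A', rfl, q⟩ | ⟨Z', h', rfl, rfl, q⟩ | ⟨A', Z', s', rfl, rfl, rfl, rfl, q⟩ := P_inv p
      · have := (ih _ _ _ _ _).2 q
        rcases h with _ | h
        · rcases s with _ | s
          · simp [T, this]
          · simp [T, this]
        · simp [T, this]
      · have := (ih _ _ _ _ _).2 q
        simp [T, this]
      · have := (ih _ _ _ _ _).2 q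
        simp [T, this]

lemma T_not {m v h s A Z} (hm : (A, Z) ∈ T m (v + 1) h s) : v ∉ A ∧ v ∉ Z := by
  have p := (mem_T _ _ _ _ _ _).1 hm
  constructor
  · intro hx; have := (p.mem v).1 (Or.inl hx); omega
  · intro hx; have := (p.mem v).1 (Or.inr hx); omega

lemma card_T (m v h s) : (T m v h s).card = bal m (h + s) := by
  have i1 : ∀ v : ℕ, Function.Injective (fun p : List ℕ × List ℕ => (v :: p.1, p.2)) := by
    rintro v ⟨a, b⟩ ⟨c, d⟩ h; simpa using h
  have i2 : ∀ v : ℕ, Function.Injective (fun p : List ℕ × List ℕ => (p.1, v :: p.2)) := by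
    rintro v ⟨a, b⟩ ⟨c, d⟩ h; simpa using h
  have i3 : ∀ v : ℕ, Function.Injective (fun p : List ℕ × List ℕ => (v :: p.1, v :: p.2)) := by
    rintro v ⟨a, b⟩ ⟨c, d⟩ h; simpa using h
  induction m generalizing v h s with
  | zero =>
    simp only [T, bal]
    split_ifs <;> first | rfl | omega
  | succ m ih =>
    rcases h with _ | h
    · rcases s with _ | s
      · simp only [T, bal]
        rw [Finset.card_image_of_injective _ (i1 v), ih]
      · simp only [T]
        rw [Finset.card_union_of_disjoint, Finset.card_image_of_injective _ (i1 v),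
          Finset.card_image_of_injective _ (i3 v), ih, ih, show 0 + (s + 1) = s + 1 by omega,
          show 1 + (s + 1) = s + 2 by omega, bal, zero_add]
        rw [Finset.disjoint_left]
        rintro ⟨A, Z⟩ h1 h2
        simp only [Finset.mem_image, Prod.exists, Prod.mk.injEq] at h1 h2
        obtain ⟨a, b, hab, rfl, rfl⟩ := h1
        obtain ⟨c, d, hcd, e, rfl⟩ := h2
        exact (T_not hab).2 (by simp)
    · simp only [T]
      rw [Finset.card_union_of_disjoint, Finset.card_image_of_injective _ (i1 v),
        Finset.card_image_of_injective _ (i2 v), ih, ih, show h + 1 + s = h + s + 1 by omega,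
        show h + 2 + s = h + s + 2 by omega, bal]
      rw [Finset.disjoint_left]
      rintro ⟨A, Z⟩ h1 h2
      simp only [Finset.mem_image, Prod.exists, Prod.mk.injEq] at h1 h2
      obtain ⟨a, b, hab, rfl, rfl⟩ := h1
      obtain ⟨c, d, hcd, e, rfl⟩ := h2
      exact (T_not hab).2 (by simp)

lemma blk_flat_inj : ∀ (L L' : List (ℕ × ℕ)), blk L = blk L' → flat L = flat L' → L = L'
  | [], [], _, _ => rfl
  | [], _ :: _, h, _ => by simp [blk_cons] at h
  | _ :: _, [], h, _ => by simp [blk_cons] at h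
  | (a, b) :: L, (c, d) :: L', h1, h2 => by
    rw [blk_cons, blk_cons] at h1
    rw [flat_cons, flat_cons] at h2
    rw [List.cons.injEq] at h1
    obtain ⟨h0, h1⟩ := h1
    have ih := blk_flat_inj L L' h1
    by_cases e1 : a = b <;> by_cases e2 : c = d <;> simp_all

lemma exists_bricks : ∀ (bl : List ℕ), (∀ x ∈ bl, x = 1 ∨ x = 2) → ∀ σ : List ℕ, σ.Nodup →
    σ.length = bl.sum → ∃ L, blk L = bl ∧ flat L = σ
  | [], _, σ, _, hl => ⟨[], rfl, by simpa [eq_comm] using hl⟩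
  | x :: bl, h, σ, nd, hl => by
    have hb : ∀ x ∈ bl, x = 1 ∨ x = 2 := fun y hy => h y (by simp [hy])
    rcases h x (by simp) with rfl | rfl
    · match σ, nd, hl with
      | [], _, hl => simp at hl; omega
      | a :: σ, nd, hl =>
        obtain ⟨L, h1, h2⟩ := exists_bricks bl hb σ (by simp at nd; exact nd.2)
          (by simp at hl; omega)
        exact ⟨(a, a) :: L, by simp [blk_cons, h1], by simp [flat_cons, h2]⟩
    · match σ, nd, hl with
      | [], _, hl => simp at hl; omega
      | [a], _, hl => simp at hl; omega
      | a :: b :: σ, nd, hl =>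
        obtain ⟨L, h1, h2⟩ := exists_bricks bl hb σ (by simp at nd; exact nd.2.2)
          (by simp at hl; omega)
        have : a ≠ b := by simp at nd; tauto
        exact ⟨(a, b) :: L, by simp [blk_cons, h1, this], by simp [flat_cons, h2, this]⟩

lemma count_le (bl : List ℕ) (h : ∀ x ∈ bl, 0 < x) : bl.count 1 + 2 * bl.count 2 ≤ bl.sum ∧
    (bl.count 1 + 2 * bl.count 2 = bl.sum → ∀ x ∈ bl, x = 1 ∨ x = 2) := by
  induction bl with
  | nil => simp
  | cons x bl ih =>
    obtain ⟨h1, h2⟩ := ih (fun y hy => h y (by simp [hy]))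
    have hx := h x (by simp)
    simp only [List.count_cons, List.sum_cons, beq_iff_eq, List.mem_cons, forall_eq_or_imp]
    split_ifs with e1 e2 e2
    · omega
    · refine ⟨by omega, fun e => ⟨by omega, h2 (by omega)⟩⟩
    · refine ⟨by omega, fun e => ⟨by omega, h2 (by omega)⟩⟩
    · exact ⟨by omega, fun e => by omega⟩

lemma count_blk (L : List (ℕ × ℕ)) : (blk L).count 1 + 2 * (blk L).count 2 = (blk L).sum := by
  induction L with
  | nil => simp
  | cons p L ih =>
    rw [blk_cons]
    split_ifs <;> simp <;> omega

lemma match_fwd {a b c d t j : ℕ} {R : List ℕ} (hj : 1 ≤ j) (hab : a < b) (hcd : c ≤ d)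
    (hcb : c < b)
    (ht : t + j + 1 ≤ 2 + (if c = d then 1 else 2))
    (hm : redL ((([a, b] ++ ((if c = d then [c] else [c, d]) ++ R)).drop t).take (j + 1)) ∈
      ({[1, 3, 2, 4], [1, 2, 3]} : Set (List ℕ))) : b < d := by
  by_contra hbd
  split_ifs at ht hm with e
  · have : t ≤ 1 := by omega
    have : j ≤ 2 := by omega
    interval_cases t <;> interval_cases j <;>
      simp [redL, List.countP_cons] at hm <;> try omega
    all_goals (split_ifs at hm <;> simp at hm)
  · have : t ≤ 2 := by omega
    have : j ≤ 3 := by omega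
    interval_cases t <;> interval_cases j <;>
      simp [redL, List.countP_cons] at hm <;> try omega
    all_goals (split_ifs at hm <;> simp at hm)

lemma match_bwd {a b c d : ℕ} (h1 : a < c) (h2 : c < b) (h3 : b < d) :
    redL [a, b, c, d] = [1, 3, 2, 4] := by
  simp [redL, List.countP_cons]
  refine ⟨?_, ?_, ?_, ?_⟩
  all_goals first | omega | (split_ifs <;> omega)

section bridge
variable {n : ℕ} {c : Composition n} {L : List (ℕ × ℕ)}

lemma drop_sz (hb : c.blocks = blk L) (i t : ℕ) :
    (flat L).drop (c.sizeUpTo i + t) = (flat (L.drop i)).drop t := by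
  rw [← drop_flat L i, List.drop_drop, Composition.sizeUpTo, hb]

lemma getD_sz (hb : c.blocks = blk L) (i t : ℕ) :
    (flat L).getD (c.sizeUpTo i + t) 0 = (flat (L.drop i)).getD t 0 := by
  rw [← drop_flat L i, Composition.sizeUpTo, hb]
  simp [List.getD_eq_getElem?_getD]

lemma len_sz (hb : c.blocks = blk L) : c.length = L.length := by
  simp [Composition.length, hb, blk]

lemma sz_succ (hb : c.blocks = blk L) (i : ℕ) (hi : i < L.length) :
    c.sizeUpTo (i + 1) = c.sizeUpTo i + (if L[i].1 = L[i].2 then 1 else 2) := by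
  rw [c.sizeUpTo_succ (by rw [len_sz hb]; exact hi)]
  simp [hb, blk]

lemma first_sz (hb : c.blocks = blk L) (i : ℕ) (hi : i < L.length) :
    (flat L).getD (c.sizeUpTo i) 0 = L[i].1 := by
  have := getD_sz hb i 0
  rw [add_zero] at this
  rw [this, List.drop_eq_getElem_cons hi, flat_cons]
  split_ifs <;> simp

lemma last_sz (hb : c.blocks = blk L) (i : ℕ) (hi : i < L.length) :
    (flat L).getD (c.sizeUpTo (i + 1) - 1) 0 = L[i].2 := by
  rw [sz_succ hb i hi]
  split_ifs with h
  · rw [Nat.add_sub_cancel, first_sz hb i hi, h]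
  · rw [show c.sizeUpTo i + 2 - 1 = c.sizeUpTo i + 1 by omega, getD_sz hb,
      List.drop_eq_getElem_cons hi, flat_cons]
    simp [h]

lemma fixed_iff (hb : c.blocks = blk L) (nd : (flat L).Nodup) :
    FixedPt {[1, 3, 2, 4], [1, 2, 3]} n c (flat L) ↔
      (∀ i (_ : i < L.length), L[i].1 ≤ L[i].2) ∧
      (∀ i (_ : i + 1 < L.length), L[i].1 < L[i + 1].1) ∧
      (∀ i (_ : i + 1 < L.length), L[i].2 < L[i + 1].2) := by
  have hlen := len_sz hb
  have key : ∀ i (hi : i + 1 < L.length) (u), (flat L).drop (c.sizeUpTo i + u) =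
      ((if L[i].1 = L[i].2 then [L[i].1] else [L[i].1, L[i].2]) ++
       ((if L[i+1].1 = L[i+1].2 then [L[i+1].1] else [L[i+1].1, L[i+1].2]) ++
         flat (L.drop (i + 2)))).drop u := by
    intro i hi u
    rw [drop_sz hb, List.drop_eq_getElem_cons (show i < L.length by omega), flat_cons,
      List.drop_eq_getElem_cons hi, flat_cons]
  constructor
  · rintro ⟨h1, h2, h3⟩
    have H1 : ∀ i (_ : i < L.length), L[i].1 ≤ L[i].2 := by
      intro i hi
      by_cases e : L[i].1 = L[i].2
      · exact e.le
      have hs := sz_succ hb i hi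
      rw [if_neg e] at hs
      have hle := c.sizeUpTo_le (i + 1)
      have := h1 (c.sizeUpTo i) (by omega) ?_
      · rw [first_sz hb i hi] at this
        have hl := last_sz hb i hi
        rw [hs, show c.sizeUpTo i + 2 - 1 = c.sizeUpTo i + 1 by omega] at hl
        rw [hl] at this
        exact this.le
      · rintro ⟨j, hj, hj'⟩
        rcases Nat.lt_or_ge i j with h | h
        · have := c.monotone_sizeUpTo (show i + 1 ≤ j from h); omega
        · have := c.monotone_sizeUpTo h; omega
    have H2 : ∀ i (_ : i + 1 < L.length), L[i].1 < L[i + 1].1 := by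
      intro i hi
      have := h2 i (by omega)
      rwa [first_sz hb i (by omega), first_sz hb (i + 1) hi] at this
    refine ⟨H1, H2, ?_⟩
    intro i hi
    have a1 := H1 i (by omega)
    have a2 := H1 (i + 1) hi
    have a3 := H2 i hi
    have a4 := h3 i (by omega)
    rw [first_sz hb (i + 1) hi, last_sz hb i (by omega)] at a4
    rcases lt_trichotomy L[i + 1].1 L[i].2 with h | h | h
    · obtain ⟨a, j, hj, ha, hs, hm⟩ := a4 h
      have e : ¬ L[i].1 = L[i].2 := by omega
      obtain ⟨t, rfl⟩ := Nat.exists_eq_add_of_le ha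
      rw [key i hi] at hm
      rw [show i + 2 = i + 1 + 1 from rfl, sz_succ hb (i + 1) hi, sz_succ hb i (by omega),
        if_neg e] at hs
      rw [if_neg e] at hm
      exact match_fwd hj (by omega) a2 h (by omega) hm
    · exfalso
      have e : ¬ L[i].1 = L[i].2 := by omega
      have := key i hi 0
      have nd' := (List.drop_sublist (c.sizeUpTo i + 0) (flat L)).nodup nd
      rw [this, if_neg e] at nd'
      split_ifs at nd' <;> simp [h] at nd'
    · omega
  · rintro ⟨H1, H2, H3⟩
    refine ⟨?_, ?_, ?_⟩
    · intro p hp hno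
      have hp' : p < n := by omega
      set i := c.index ⟨p, hp'⟩ with hi
      have l1 : c.sizeUpTo i ≤ p := c.sizeUpTo_index_le ⟨p, hp'⟩
      have l2 : p < c.sizeUpTo (i + 1) := c.lt_sizeUpTo_index_succ ⟨p, hp'⟩
      have hiL : (i : ℕ) < L.length := by have := i.2; omega
      have hs := sz_succ hb i hiL
      by_cases hq : c.sizeUpTo (i + 1) = p + 1
      · exfalso
        apply hno
        refine ⟨i + 1, ?_, hq⟩
        by_contra hge
        have hee : (i : ℕ) + 1 = c.length := by have := i.2; omega
        rw [hee, c.sizeUpTo_length] at hq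
        omega
      · have e : ¬ L[(i : ℕ)].1 = L[(i : ℕ)].2 := by
          intro e; rw [if_pos e] at hs; omega
        rw [if_neg e] at hs
        have hpe : p = c.sizeUpTo i := by omega
        have hl := last_sz hb i hiL
        rw [hs, show c.sizeUpTo i + 2 - 1 = c.sizeUpTo i + 1 by omega] at hl
        rw [hpe, hl, first_sz hb i hiL]
        have := H1 i hiL
        omega
    · intro i hi
      rw [first_sz hb i (by omega), first_sz hb (i + 1) (by omega)]
      exact H2 i (by omega)
    · intro i hi hd
      have hi' : i + 1 < L.length := by omega
      rw [first_sz hb (i + 1) hi', last_sz hb i (by omega)] at hd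
      have a1 := H1 i (by omega)
      have a2 := H1 (i + 1) hi'
      have a3 := H2 i hi'
      have a4 := H3 i hi'
      have e : ¬ L[i].1 = L[i].2 := by omega
      have e' : ¬ L[i + 1].1 = L[i + 1].2 := by omega
      refine ⟨c.sizeUpTo i, 3, by omega, le_rfl, ?_, ?_⟩
      · rw [show i + 2 = i + 1 + 1 from rfl, sz_succ hb (i + 1) hi', sz_succ hb i (by omega),
          if_neg e, if_neg e']
      · have := key i hi' 0
        rw [add_zero, if_neg e, if_neg e'] at this
        rw [this]
        left
        simpa using match_bwd a3 hd a4

end bridge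

lemma pw_iff (l : List ℕ) : l.Pairwise (· < ·) ↔
    ∀ i (_ : i + 1 < l.length), l[i] < l[i + 1] := by
  rw [← List.isChain_iff_pairwise, List.isChain_iff_getElem]

lemma P_iff {n k : ℕ} (c : Composition (2 * n)) (L : List (ℕ × ℕ)) (hb : c.blocks = blk L)
    (hk : k ≤ n) :
    P (2 * n) 1 0 (2 * k) (L.map Prod.fst) (L.map Prod.snd) ↔
    (flat L).Perm (List.range' 1 (2 * n)) ∧
      c.blocks.count 1 = 2 * k ∧ c.blocks.count 2 = n - k ∧
      FixedPt {[1, 3, 2, 4], [1, 2, 3]} (2 * n) c (flat L) := by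
  have hz : (L.map Prod.fst).zip (L.map Prod.snd) = L := by
    rw [← List.unzip_fst, ← List.unzip_snd, List.zip_unzip]
  have hc := count_blk L
  have hsum : (blk L).sum = 2 * n := by rw [← hb, c.blocks_sum]
  constructor
  · rintro ⟨sA, sZ, f, -, cnt, pm⟩
    simp only [List.drop_zero, List.take_zero, List.append_nil, hz] at f cnt pm
    refine ⟨pm, by rw [hb, cnt], by rw [hb]; omega, ?_⟩
    rw [fixed_iff hb (pm.nodup_iff.2 List.nodup_range')]
    rw [pw_iff] at sA sZ
    rw [List.forall₂_iff_get] at f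
    refine ⟨fun i hi => ?_, fun i hi => ?_, fun i hi => ?_⟩
    · simpa using f.2 i (by simpa using hi) (by simpa using hi)
    · have hi2 : i + 1 < (L.map Prod.fst).length := by simpa using hi
      have := sA i hi2
      rwa [List.getElem_map, List.getElem_map] at this
    · have hi2 : i + 1 < (L.map Prod.snd).length := by simpa using hi
      have := sZ i hi2
      rwa [List.getElem_map, List.getElem_map] at this
  · rintro ⟨pm, c1, c2, hf⟩
    rw [fixed_iff hb (pm.nodup_iff.2 List.nodup_range')] at hf
    refine ⟨?_, ?_, ?_, by simp, ?_, ?_⟩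
    · rw [pw_iff]; intro i hi; simpa using hf.2.1 i (by simpa using hi)
    · rw [pw_iff]; intro i hi; simpa using hf.2.2 i (by simpa using hi)
    · rw [List.forall₂_iff_get]
      refine ⟨by simp, fun i h1 h2 => ?_⟩
      simpa using hf.1 i (by simpa using h1)
    · rw [List.drop_zero, hz, ← hb, c1]
    · simpa [hz] using pm

open scoped Classical in
theorem stmt12 (Γ : Set (List ℕ)) (hΓ : Γ = {[1, 3, 2, 4], [1, 2, 3]})
    (n k : ℕ) (hk : k ≤ n) :
    ((Finset.filter
        (fun cs : Composition (2 * n) × List ℕ =>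
          cs.1.blocks.count 1 = 2 * k ∧ cs.1.blocks.count 2 = n - k ∧
            FixedPt Γ (2 * n) cs.1 cs.2)
        ((Finset.univ : Finset (Composition (2 * n))) ×ˢ
          (List.range' 1 (2 * n)).permutations.toFinset)).card : ℚ)
      = (2 * (k : ℚ) + 1) * ((2 * n).choose (n - k) : ℚ) / ((n : ℚ) + k + 1) := by
  subst hΓ
  have hcard : (T (2 * n) 1 0 (2 * k)).card = bal (2 * n) (2 * k) := by
    rw [card_T, zero_add]
  have hcl := bal_closed (2 * n) (2 * k) (n - k) (by omega)
  have hden : ((2 * k : ℕ) : ℚ) + ((n - k : ℕ) : ℚ) + 1 = (n : ℚ) + k + 1 := by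
    rw [Nat.cast_sub hk]; push_cast; ring
  rw [hden] at hcl
  push_cast at hcl
  rw [← hcl, ← hcard]
  congr 1
  symm
  have hP : ∀ a ∈ T (2 * n) 1 0 (2 * k), ∃ L : List (ℕ × ℕ), a = (L.map Prod.fst, L.map Prod.snd) ∧
      a.1.zip a.2 = L ∧ (blk L).sum = 2 * n := by
    rintro ⟨A, Z⟩ ha
    have p := (mem_T _ _ _ _ _ _).1 ha
    have hl : A.length = Z.length := by simpa using p.f.length_eq
    have pm := p.pm.length_eq
    refine ⟨A.zip Z, ?_, rfl, ?_⟩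
    · rw [List.map_fst_zip hl.le, List.map_snd_zip hl.ge]
    · rw [← length_flat]; simpa using pm
  have hpos : ∀ L : List (ℕ × ℕ), ∀ {i}, i ∈ blk L → 0 < i := by
    intro L i hi
    simp only [blk, List.mem_map] at hi
    obtain ⟨p, -, rfl⟩ := hi
    split_ifs <;> omega
  refine Finset.card_bij (fun a ha => ((⟨blk (a.1.zip a.2), hpos _, by
      obtain ⟨L, -, h2, h3⟩ := hP a ha
      rw [h2, h3]⟩ : Composition (2 * n)), flat (a.1.zip a.2))) ?_ ?_ ?_
  · intro a ha
    obtain ⟨L, h1, h2, h3⟩ := hP a ha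
    have p := (mem_T _ _ _ _ _ _).1 (h1 ▸ ha)
    simp only [h2]
    have q := (P_iff ⟨blk L, hpos _, h3⟩ L rfl hk).1 p
    simp only [Finset.mem_filter, Finset.mem_product, Finset.mem_univ, true_and,
      List.mem_toFinset, List.mem_permutations]
    exact q
  · intro a ha b hb hab
    obtain ⟨L, h1, h2, h3⟩ := hP a ha
    obtain ⟨L', h1', h2', h3'⟩ := hP b hb
    simp only [h2, h2', Prod.mk.injEq, Composition.mk.injEq] at hab
    rw [h1, h1', blk_flat_inj L L' hab.1 hab.2]
  · rintro ⟨c, σ⟩ hm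
    simp only [Finset.mem_filter, Finset.mem_product, Finset.mem_univ, true_and,
      List.mem_toFinset, List.mem_permutations] at hm
    obtain ⟨pm, c1, c2, hf⟩ := hm
    have hcs := c.blocks_sum
    obtain ⟨L, hL, rfl⟩ := exists_bricks c.blocks
      ((count_le c.blocks (fun x hx => c.blocks_pos hx)).2 (by omega)) σ
      (pm.nodup_iff.2 List.nodup_range') (by rw [pm.length_eq, hcs]; simp)
    have p := (P_iff c L hL.symm hk).2 ⟨pm, c1, c2, hf⟩
    have hz : (L.map Prod.fst).zip (L.map Prod.snd) = L := by
      rw [← List.unzip_fst, ← List.unzip_snd, List.zip_unzip]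
    refine ⟨(L.map Prod.fst, L.map Prod.snd), (mem_T _ _ _ _ _ _).2 p, ?_⟩
    simp only [hz, Prod.mk.injEq, and_true]
    exact Composition.ext hL
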